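/- Let G be a countable discrete group which is nonamenable, has property A (equivalently, is exact), and admits an unbounded 1-cocycle into a countable multiple of its left regular representation (for nonamenable countable groups this is equivalent to positivity of the first ℓ²-Betti number β₁⁽²⁾(G) > 0). Then G is properly proximal. [Theorem 1.1 of the paper, with β₁⁽²⁾(G) > 0 expressed through its cocycle characterization.] -/

import Mathlib

open scoped Classical

/-- The bounded complex-valued functions on `H`, i.e. `ℓ∞(H)`. -/
def BddFuns (H : Type*) : Set (H → ℂ) := {f | ∃ C : ℝ, ∀ x, ‖f x‖ ≤ C}

/-- The small-at-infinity boundary algebra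
`𝕊(H) = {f ∈ ℓ∞(H) : ∀ t, s ↦ f(st) − f(s) ∈ c₀(H)}`. -/
def SmallAtInfinity (H : Type*) [Group H] : Set (H → ℂ) :=
  {f | f ∈ BddFuns H ∧ ∀ t : H, ∀ ε : ℝ, 0 < ε → {s : H | ε ≤ ‖f (s * t) - f s‖}.Finite}

/-- There is a state (unital, linear and positive on `S`) on the functions in `S` that is
invariant under the left translation action of `H`. -/
def HasLeftInvariantState (H : Type*) [Group H] (S : Set (H → ℂ)) : Prop :=
  ∃ φ : (H → ℂ) → ℂ,
    φ (fun _ => 1) = 1 ∧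
    (∀ f ∈ S, ∀ g ∈ S, φ (f + g) = φ f + φ g) ∧
    (∀ (c : ℂ), ∀ f ∈ S, φ (c • f) = c * φ f) ∧
    (∀ f ∈ S, (∀ x, 0 ≤ (f x).re ∧ (f x).im = 0) → 0 ≤ (φ f).re ∧ (φ f).im = 0) ∧
    (∀ t : H, ∀ f ∈ S, φ (fun s => f (t⁻¹ * s)) = φ f)

/-- `H` is amenable: there is a left-translation-invariant state on `ℓ∞(H)`. -/
def AmenableGroup (H : Type*) [Group H] : Prop := HasLeftInvariantState H (BddFuns H)

/-- `H` is properly proximal: there is no left-translation-invariant state on `𝕊(H)`. -/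
def ProperlyProximalGroup (H : Type*) [Group H] : Prop :=
  ¬ HasLeftInvariantState H (SmallAtInfinity H)

/-- Yu's property A (equivalently, exactness) for a countable discrete group: for every finite
`F ⊆ H` and `ε > 0` there are a finite `K ⊆ H` and `μ_g ∈ ℓ¹(H)` with `μ_g ≥ 0`, `‖μ_g‖₁ = 1`,
`supp μ_g ⊆ gK`, and `‖μ_g − μ_h‖₁ < ε` whenever `g⁻¹h ∈ F`. -/
def HasPropertyA (H : Type*) [Group H] : Prop :=
  ∀ (F : Finset H) (ε : ℝ), 0 < ε →
    ∃ (K : Finset H) (m : H → H → ℝ),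
      (∀ g x, 0 ≤ m g x) ∧
      (∀ g x, m g x ≠ 0 → ∃ k ∈ K, x = g * k) ∧
      (∀ g : H, ∑ k ∈ K, m g (g * k) = 1) ∧
      (∀ g h : H, g⁻¹ * h ∈ F →
        ∑ x ∈ K.image (fun k => g * k) ∪ K.image (fun k => h * k), |m g x - m h x| < ε)

namespace ProperProximality

open Filter Topology
open scoped ComplexOrder

/-- The complex Hilbert space `ℓ²(X)`. -/
noncomputable abbrev SqSummable (X : Type*) := lp (fun _ : X => ℂ) 2

section SqSummable

variable {X : Type*}

lemma hasSum_sq (v : SqSummable X) : HasSum (fun x => ‖v x‖ ^ 2) (‖v‖ ^ 2) := by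
  have h := lp.hasSum_norm (p := 2) (by norm_num) v
  simpa using h

lemma memℓp_two_of_summable {f : X → ℂ} (h : Summable fun x => ‖f x‖ ^ 2) : Memℓp f 2 :=
  memℓp_gen (by simpa using h)

/-- Restriction of a vector to a finite set of coordinates. -/
noncomputable def trunc (E : Finset X) (v : SqSummable X) : SqSummable X :=
  ⟨fun x => if x ∈ E then v x else 0, memℓp_two_of_summable (by
    refine Summable.of_nonneg_of_le (fun _ => by positivity) (fun x => ?_) (hasSum_sq v).summable
    split_ifs <;> simp)⟩

lemma trunc_apply (E : Finset X) (v : SqSummable X) (x : X) :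
    trunc E v x = if x ∈ E then v x else 0 := rfl

/-- The unitary operator permuting the coordinates along `e`. -/
noncomputable def permute (e : X ≃ X) (v : SqSummable X) : SqSummable X :=
  ⟨fun x => v (e.symm x), memℓp_two_of_summable (by
    exact (e.symm.summable_iff (f := fun x => ‖v x‖ ^ 2)).2 (hasSum_sq v).summable)⟩

lemma permute_apply (e : X ≃ X) (v : SqSummable X) (x : X) : permute e v x = v (e.symm x) := rfl

lemma norm_permute (e : X ≃ X) (v : SqSummable X) : ‖permute e v‖ = ‖v‖ := by
  have h1 := (hasSum_sq (permute e v)).unique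
    ((e.symm.hasSum_iff (f := fun x => ‖v x‖ ^ 2)).2 (hasSum_sq v))
  exact (sq_eq_sq₀ (norm_nonneg _) (norm_nonneg _)).1 h1

lemma norm_sq_trunc (E : Finset X) (v : SqSummable X) : ‖trunc E v‖ ^ 2 = ∑ x ∈ E, ‖v x‖ ^ 2 := by
  refine (hasSum_sq (trunc E v)).unique ?_
  have : ∑ x ∈ E, ‖v x‖ ^ 2 = ∑ x ∈ E, ‖trunc E v x‖ ^ 2 :=
    Finset.sum_congr rfl fun x hx => by simp [trunc_apply, hx]
  rw [this]
  exact hasSum_sum_of_ne_finset_zero fun x hx => by simp [trunc_apply, hx]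

lemma norm_le_of_pointwise {v w : SqSummable X} (h : ∀ x, ‖v x‖ ≤ ‖w x‖) : ‖v‖ ≤ ‖w‖ := by
  refine (sq_le_sq₀ (norm_nonneg _) (norm_nonneg _)).1 ?_
  exact hasSum_le (fun x => pow_le_pow_left₀ (norm_nonneg _) (h x) 2) (hasSum_sq v) (hasSum_sq w)

lemma norm_trunc_le (E : Finset X) (v : SqSummable X) : ‖trunc E v‖ ≤ ‖v‖ :=
  norm_le_of_pointwise fun x => by rw [trunc_apply]; split_ifs <;> simp

lemma norm_trunc_apply_mono {S T : Finset X} (h : S ⊆ T) (v : SqSummable X) (x : X) :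
    ‖trunc S v x‖ ≤ ‖trunc T v x‖ := by
  simp only [trunc_apply]
  by_cases hx : x ∈ S
  · simp [hx, h hx]
  · simp [hx]

lemma norm_trunc_mono {S T : Finset X} (h : S ⊆ T) (v : SqSummable X) :
    ‖trunc S v‖ ≤ ‖trunc T v‖ :=
  norm_le_of_pointwise (norm_trunc_apply_mono h v)

lemma trunc_sub (E : Finset X) (v w : SqSummable X) :
    trunc E (v - w) = trunc E v - trunc E w := by
  ext x
  simp only [trunc_apply, lp.coeFn_sub, Pi.sub_apply]
  split_ifs <;> simp

lemma permute_trunc (e : X ≃ X) (E : Finset X) (v : SqSummable X) :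
    permute e (trunc E v) = trunc (E.map e.toEmbedding) (permute e v) := by
  ext x
  simp [permute_apply, trunc_apply]

/-- The integral of `F` against the measure on `X` with density `|v|²`. -/
noncomputable def weightedSum (F : X → ℂ) (v : SqSummable X) : ℂ :=
  ∑' x, F x * ((‖v x‖ ^ 2 : ℝ) : ℂ)

variable {F : X → ℂ} {C : ℝ}

lemma summable_weightedSum (hF : ∀ x, ‖F x‖ ≤ C) (v : SqSummable X) :
    Summable fun x => F x * ((‖v x‖ ^ 2 : ℝ) : ℂ) := by
  refine Summable.of_norm_bounded ((hasSum_sq v).summable.mul_left C) fun x => ?_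
  rw [norm_mul, Complex.norm_real, Real.norm_of_nonneg (by positivity)]
  exact mul_le_mul_of_nonneg_right (hF x) (by positivity)

lemma norm_weightedSum_sub_le_of_pointwise (hF : ∀ x, ‖F x‖ ≤ C) {v w : SqSummable X}
    (h : ∀ x, ‖v x‖ ≤ ‖w x‖) :
    ‖weightedSum F w - weightedSum F v‖ ≤ C * (‖w‖ ^ 2 - ‖v‖ ^ 2) := by
  rw [weightedSum, weightedSum,
    ← (summable_weightedSum hF w).tsum_sub (summable_weightedSum hF v)]
  refine tsum_of_norm_bounded (((hasSum_sq w).sub (hasSum_sq v)).mul_left C) fun x => ?_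
  have h0 : (0 : ℝ) ≤ ‖w x‖ ^ 2 - ‖v x‖ ^ 2 :=
    sub_nonneg.2 (pow_le_pow_left₀ (norm_nonneg _) (h x) 2)
  rw [← mul_sub, ← Complex.ofReal_sub, norm_mul, Complex.norm_real, Real.norm_of_nonneg h0]
  exact mul_le_mul_of_nonneg_right (hF x) h0

lemma norm_weightedSum_le (hF : ∀ x, ‖F x‖ ≤ C) (v : SqSummable X) :
    ‖weightedSum F v‖ ≤ C * ‖v‖ ^ 2 := by
  refine tsum_of_norm_bounded ((hasSum_sq v).mul_left C) fun x => ?_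
  rw [norm_mul, Complex.norm_real, Real.norm_of_nonneg (by positivity)]
  exact mul_le_mul_of_nonneg_right (hF x) (by positivity)

lemma norm_weightedSum_sub_le (hC : 0 ≤ C) (hF : ∀ x, ‖F x‖ ≤ C) (v w : SqSummable X) :
    ‖weightedSum F v - weightedSum F w‖ ≤ C * (‖v - w‖ * (‖v‖ + ‖w‖)) := by
  have hpq : Real.HolderConjugate (2 : ENNReal).toReal (2 : ENNReal).toReal := by
    simpa using Real.HolderConjugate.two_two
  have s1 := lp.summable_mul hpq (v - w) v
  have s2 := lp.summable_mul hpq (v - w) w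
  have b1 := lp.tsum_mul_le_mul_norm' hpq (v - w) v
  have b2 := lp.tsum_mul_le_mul_norm' hpq (v - w) w
  rw [weightedSum, weightedSum,
    ← (summable_weightedSum hF v).tsum_sub (summable_weightedSum hF w)]
  refine (tsum_of_norm_bounded ((s1.hasSum.add s2.hasSum).mul_left C) fun x => ?_).trans
    (mul_le_mul_of_nonneg_left (by rw [mul_add]; exact add_le_add b1 b2) hC)
  rw [← mul_sub, ← Complex.ofReal_sub, norm_mul, Complex.norm_real, Real.norm_eq_abs]
  refine mul_le_mul (hF x) ?_ (abs_nonneg _) hC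
  rw [lp.coeFn_sub, Pi.sub_apply, ← mul_add, sq_sub_sq, abs_mul, mul_comm,
    abs_of_nonneg (by positivity : (0 : ℝ) ≤ ‖v x‖ + ‖w x‖)]
  exact mul_le_mul_of_nonneg_right (abs_norm_sub_norm_le _ _) (by positivity)

lemma weightedSum_smul (c : ℝ) (v : SqSummable X) :
    weightedSum F ((c : ℂ) • v) = (c : ℂ) ^ 2 * weightedSum F v := by
  rw [weightedSum, weightedSum, ← tsum_mul_left]
  congr 1
  ext x
  simp only [lp.coeFn_smul, Pi.smul_apply, smul_eq_mul, norm_mul, Complex.norm_real, mul_pow,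
    Real.norm_eq_abs, sq_abs]
  push_cast
  ring

lemma weightedSum_permute (e : X ≃ X) (v : SqSummable X) :
    weightedSum F (permute e v) = weightedSum (F ∘ e) v := by
  rw [weightedSum, weightedSum, ← e.tsum_eq]
  simp [permute_apply]

lemma weightedSum_add {F' : X → ℂ} {C' : ℝ} (hF : ∀ x, ‖F x‖ ≤ C) (hF' : ∀ x, ‖F' x‖ ≤ C')
    (v : SqSummable X) : weightedSum (F + F') v = weightedSum F v + weightedSum F' v := by
  rw [weightedSum, weightedSum, weightedSum,
    ← (summable_weightedSum hF v).tsum_add (summable_weightedSum hF' v)]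
  simp [add_mul]

lemma weightedSum_const_smul (c : ℂ) (F : X → ℂ) (v : SqSummable X) :
    weightedSum (c • F) v = c * weightedSum F v := by
  rw [weightedSum, weightedSum, ← tsum_mul_left]
  simp [mul_assoc]

lemma weightedSum_one (v : SqSummable X) :
    weightedSum (fun _ => 1) v = ((‖v‖ ^ 2 : ℝ) : ℂ) := by
  rw [weightedSum]
  simp only [one_mul]
  exact (Complex.hasSum_ofReal.2 (hasSum_sq v)).tsum_eq

lemma weightedSum_nonneg (hF : ∀ x, 0 ≤ F x) (v : SqSummable X) : 0 ≤ weightedSum F v :=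
  tsum_nonneg fun x => mul_nonneg (hF x) (by exact_mod_cast (by positivity : (0 : ℝ) ≤ ‖v x‖ ^ 2))

/-- The integral of `F` against the measure with density `|v|² / (R² + ‖v‖²)`. -/
noncomputable def damped (R : ℝ) (F : X → ℂ) (v : SqSummable X) : ℂ :=
  weightedSum F v / ((R ^ 2 + ‖v‖ ^ 2 : ℝ) : ℂ)

/-- The total mass of the measure with density `|v|² / (R² + ‖v‖²)`. -/
noncomputable def dampedMass (R : ℝ) (v : SqSummable X) : ℝ := ‖v‖ ^ 2 / (R ^ 2 + ‖v‖ ^ 2)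

variable {R R' : ℝ}

lemma damped_one (R : ℝ) (v : SqSummable X) :
    damped R (fun _ => 1) v = (dampedMass R v : ℂ) := by
  rw [damped, weightedSum_one, dampedMass]
  push_cast
  rfl

lemma dampedMass_nonneg (R : ℝ) (v : SqSummable X) : 0 ≤ dampedMass R v := by
  rw [dampedMass]; positivity

lemma dampedMass_le_one (R : ℝ) (v : SqSummable X) : dampedMass R v ≤ 1 :=
  div_le_one_of_le₀ (by nlinarith [sq_nonneg R]) (by positivity)

lemma damped_add {F' : X → ℂ} {C' : ℝ} (hF : ∀ x, ‖F x‖ ≤ C) (hF' : ∀ x, ‖F' x‖ ≤ C')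
    (v : SqSummable X) : damped R (F + F') v = damped R F v + damped R F' v := by
  rw [damped, weightedSum_add hF hF', add_div]; rfl

lemma damped_const_smul (c : ℂ) (F : X → ℂ) (v : SqSummable X) :
    damped R (c • F) v = c * damped R F v := by
  rw [damped, weightedSum_const_smul, mul_div_assoc]; rfl

lemma damped_nonneg (hF : ∀ x, 0 ≤ F x) (v : SqSummable X) : 0 ≤ damped R F v := by
  rw [damped, div_eq_mul_inv, ← Complex.ofReal_inv]
  refine mul_nonneg (weightedSum_nonneg hF v) ?_
  exact_mod_cast (by positivity : (0 : ℝ) ≤ (R ^ 2 + ‖v‖ ^ 2)⁻¹)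

lemma damped_permute (e : X ≃ X) (v : SqSummable X) :
    damped R F (permute e v) = damped R (F ∘ e) v := by
  rw [damped, weightedSum_permute, norm_permute]; rfl

lemma norm_damped_le (hC : 0 ≤ C) (hF : ∀ x, ‖F x‖ ≤ C) (v : SqSummable X) :
    ‖damped R F v‖ ≤ C := by
  have h0 : 0 ≤ R ^ 2 + ‖v‖ ^ 2 := by positivity
  rw [damped, norm_div, Complex.norm_real, Real.norm_of_nonneg h0]
  refine div_le_of_le_mul₀ h0 hC ((norm_weightedSum_le hF v).trans ?_)
  exact mul_le_mul_of_nonneg_left (by nlinarith [sq_nonneg R]) hC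

lemma norm_damped_sub_le (hR : 0 < R) (hR' : 0 < R') (hC : 0 ≤ C) (hF : ∀ x, ‖F x‖ ≤ C)
    (v w : SqSummable X) :
    ‖damped R F v - damped R' F w‖ ≤ 4 * C * (‖v - w‖ + |R - R'|) / R := by
  set p := Real.sqrt (R ^ 2 + ‖v‖ ^ 2) with hp
  set q := Real.sqrt (R' ^ 2 + ‖w‖ ^ 2) with hq
  have hp2 : p ^ 2 = R ^ 2 + ‖v‖ ^ 2 := Real.sq_sqrt (by positivity)
  have hq2 : q ^ 2 = R' ^ 2 + ‖w‖ ^ 2 := Real.sq_sqrt (by positivity)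
  have hRp : R ≤ p := Real.le_sqrt_of_sq_le (by nlinarith [norm_nonneg v])
  have hvp : ‖v‖ ≤ p := Real.le_sqrt_of_sq_le (by nlinarith)
  have hRq : R' ≤ q := Real.le_sqrt_of_sq_le (by nlinarith [norm_nonneg w])
  have hwq : ‖w‖ ≤ q := Real.le_sqrt_of_sq_le (by nlinarith)
  have hp0 : 0 < p := hR.trans_le hRp
  have hq0 : 0 < q := hR'.trans_le hRq
  have hpq : |p - q| ≤ ‖v - w‖ + |R - R'| := by
    have h1 : (p - q) * (p + q) = (R - R') * (R + R') + (‖v‖ - ‖w‖) * (‖v‖ + ‖w‖) := by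
      nlinarith
    have h2 : |p - q| * (p + q) ≤ (‖v - w‖ + |R - R'|) * (p + q) := by
      have h3 : |p - q| * (p + q) = |(p - q) * (p + q)| := by
        rw [abs_mul, abs_of_pos (by positivity : 0 < p + q)]
      rw [h3, h1, add_mul, add_comm]
      refine (abs_add_le _ _).trans (add_le_add ?_ ?_)
      · rw [abs_mul, abs_of_nonneg (by positivity : 0 ≤ ‖v‖ + ‖w‖)]
        exact mul_le_mul (abs_norm_sub_norm_le v w) (by linarith) (by positivity) (norm_nonneg _)
      · rw [abs_mul, abs_of_pos (by positivity : 0 < R + R')]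
        exact mul_le_mul_of_nonneg_left (by linarith) (abs_nonneg _)
    exact le_of_mul_le_mul_right h2 (by positivity)
  have key : ∀ (r : ℝ) (S : ℝ) (u : SqSummable X), 0 < r → r ^ 2 = S ^ 2 + ‖u‖ ^ 2 →
      damped S F u = weightedSum F (((r⁻¹ : ℝ) : ℂ) • u) := by
    intro r S u hr h
    rw [weightedSum_smul, damped, ← h]
    push_cast
    field_simp
  rw [key p R v hp0 hp2, key q R' w hq0 hq2]
  have nv : ‖((p⁻¹ : ℝ) : ℂ) • v‖ ≤ 1 := by
    rw [norm_smul, Complex.norm_real, Real.norm_of_nonneg (by positivity), inv_mul_le_one₀ hp0]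
    exact hvp
  have nw : ‖((q⁻¹ : ℝ) : ℂ) • w‖ ≤ 1 := by
    rw [norm_smul, Complex.norm_real, Real.norm_of_nonneg (by positivity), inv_mul_le_one₀ hq0]
    exact hwq
  have nd : ‖((p⁻¹ : ℝ) : ℂ) • v - ((q⁻¹ : ℝ) : ℂ) • w‖ ≤ 2 * (‖v - w‖ + |R - R'|) / R := by
    have e : ((p⁻¹ : ℝ) : ℂ) • v - ((q⁻¹ : ℝ) : ℂ) • w
        = ((p⁻¹ : ℝ) : ℂ) • (v - w) + (((q - p) * p⁻¹ : ℝ) : ℂ) • (((q⁻¹ : ℝ) : ℂ) • w) := by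
      rw [smul_sub, smul_smul, sub_add, ← sub_smul]
      congr 2
      have : (p : ℂ) ≠ 0 := by exact_mod_cast hp0.ne'
      have : (q : ℂ) ≠ 0 := by exact_mod_cast hq0.ne'
      push_cast
      field_simp
      ring
    rw [e]
    have hip : p⁻¹ ≤ R⁻¹ := inv_anti₀ hR hRp
    have hδ : 0 ≤ ‖v - w‖ + |R - R'| := by positivity
    calc _ ≤ p⁻¹ * ‖v - w‖ + |q - p| * p⁻¹ * 1 := by
          refine (norm_add_le _ _).trans (add_le_add ?_ ?_)
          · rw [norm_smul, Complex.norm_real, Real.norm_of_nonneg (by positivity)]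
          · rw [norm_smul, Complex.norm_real, Real.norm_eq_abs, abs_mul, abs_of_pos (inv_pos.2 hp0)]
            exact mul_le_mul_of_nonneg_left nw (by positivity)
      _ ≤ R⁻¹ * (‖v - w‖ + |R - R'|) + (‖v - w‖ + |R - R'|) * R⁻¹ * 1 := by
          rw [abs_sub_comm] at hpq
          gcongr
          linarith [abs_nonneg (R - R')]
      _ = _ := by field_simp; ring
  refine (norm_weightedSum_sub_le hC hF _ _).trans ?_
  have hδ : 0 ≤ 2 * (‖v - w‖ + |R - R'|) / R := by positivity
  calc _ ≤ C * (2 * (‖v - w‖ + |R - R'|) / R * (1 + 1)) := by gcongr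
    _ = _ := by ring

/-- Enlarging the support changes the damped measure by at most the increment of
`log (R² + ‖·‖²)`. -/
lemma norm_damped_sub_le_log (hR : 0 < R) (hC : 0 ≤ C) (hF : ∀ x, ‖F x‖ ≤ C)
    {v w : SqSummable X} (h : ∀ x, ‖v x‖ ≤ ‖w x‖) :
    ‖damped R F v - damped R F w‖
      ≤ 2 * C * (Real.log (R ^ 2 + ‖w‖ ^ 2) - Real.log (R ^ 2 + ‖v‖ ^ 2)) := by
  have hvw : ‖v‖ ^ 2 ≤ ‖w‖ ^ 2 :=
    pow_le_pow_left₀ (norm_nonneg _) (norm_le_of_pointwise h) 2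
  set a := R ^ 2 + ‖v‖ ^ 2 with ha
  set c := R ^ 2 + ‖w‖ ^ 2 with hc
  have ha0 : 0 < a := by positivity
  have hc0 : 0 < c := by positivity
  have hac : a ≤ c := by linarith
  have hlog : (c - a) / c ≤ Real.log c - Real.log a := by
    rw [← Real.log_div hc0.ne' ha0.ne']
    have := Real.one_sub_inv_le_log_of_pos (div_pos hc0 ha0)
    rwa [inv_div, one_sub_div hc0.ne'] at this
  have e : damped R F v - damped R F w
      = -((weightedSum F w - weightedSum F v) / (c : ℂ))
        + damped R F v * (((c - a) / c : ℝ) : ℂ) := by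
    have : (a : ℂ) ≠ 0 := by exact_mod_cast ha0.ne'
    have : (c : ℂ) ≠ 0 := by exact_mod_cast hc0.ne'
    rw [damped, damped, ← ha, ← hc]
    push_cast
    field_simp
    ring
  rw [e]
  have hq : 0 ≤ (c - a) / c := div_nonneg (by linarith) hc0.le
  calc _ ≤ C * (c - a) / c + C * ((c - a) / c) := by
        refine (norm_add_le _ _).trans (add_le_add ?_ ?_)
        · rw [norm_neg, norm_div, Complex.norm_real, Real.norm_of_nonneg hc0.le]
          refine div_le_div_of_nonneg_right ((norm_weightedSum_sub_le_of_pointwise hF h).trans ?_)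
            hc0.le
          rw [ha, hc, add_sub_add_left_eq_sub]
        · rw [norm_mul, Complex.norm_real, Real.norm_of_nonneg hq]
          exact mul_le_mul_of_nonneg_right (norm_damped_le hC hF v) hq
    _ = 2 * C * ((c - a) / c) := by ring
    _ ≤ _ := mul_le_mul_of_nonneg_left hlog (by positivity)

end SqSummable

/-- A unital linear functional, positive on `S` and invariant under left translation. -/
structure IsLeftInvariantState {H : Type*} [Group H] (S : Set (H → ℂ)) (φ : (H → ℂ) → ℂ) :
    Prop where
  map_one : φ (fun _ => 1) = 1
  map_add : ∀ f ∈ S, ∀ g ∈ S, φ (f + g) = φ f + φ g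
  map_smul : ∀ (c : ℂ), ∀ f ∈ S, φ (c • f) = c * φ f
  nonneg : ∀ f ∈ S, (∀ x, 0 ≤ (f x).re ∧ (f x).im = 0) → 0 ≤ (φ f).re ∧ (φ f).im = 0
  map_translate : ∀ t : H, ∀ f ∈ S, φ (fun s => f (t⁻¹ * s)) = φ f

section State

variable {H : Type*} [Group H]

lemma mem_smallAtInfinity_iff {f : H → ℂ} : f ∈ SmallAtInfinity H ↔
    f ∈ BddFuns H ∧ ∀ t : H, Tendsto (fun s => f (s * t) - f s) cofinite (𝓝 0) := by
  refine and_congr_right fun _ => forall_congr' fun t => ?_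
  rw [Metric.tendsto_nhds]
  refine forall₂_congr fun ε _ => ?_
  rw [eventually_cofinite]
  simp

lemma bddFuns_add {X : Type*} {f g : X → ℂ} (hf : f ∈ BddFuns X) (hg : g ∈ BddFuns X) :
    f + g ∈ BddFuns X := by
  obtain ⟨C, hC⟩ := hf
  obtain ⟨D, hD⟩ := hg
  exact ⟨C + D, fun x => norm_add_le_of_le (hC x) (hD x)⟩

lemma smallAtInfinity_add {f g : H → ℂ} (hf : f ∈ SmallAtInfinity H)
    (hg : g ∈ SmallAtInfinity H) : f + g ∈ SmallAtInfinity H := by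
  rw [mem_smallAtInfinity_iff] at *
  refine ⟨bddFuns_add hf.1 hg.1, fun t => ?_⟩
  simpa [add_sub_add_comm] using (hf.2 t).add (hg.2 t)

lemma smallAtInfinity_comp {f : H → ℂ} (hf : f ∈ SmallAtInfinity H) (L : ℂ →L[ℝ] ℂ) :
    (fun x => L (f x)) ∈ SmallAtInfinity H := by
  rw [mem_smallAtInfinity_iff] at *
  obtain ⟨⟨C, hC⟩, hf⟩ := hf
  refine ⟨⟨‖L‖ * C, fun x => L.le_opNorm_of_le (hC x)⟩, fun t => ?_⟩
  simpa [Function.comp_def] using (L.continuous.tendsto 0).comp (hf t)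

lemma smallAtInfinity_smul {f : H → ℂ} (hf : f ∈ SmallAtInfinity H) (c : ℂ) :
    c • f ∈ SmallAtInfinity H :=
  smallAtInfinity_comp hf (ContinuousLinearMap.mul ℝ ℂ c)

lemma const_mem_smallAtInfinity (c : ℂ) : (fun _ => c) ∈ SmallAtInfinity H := by
  rw [mem_smallAtInfinity_iff]
  exact ⟨⟨‖c‖, fun _ => le_rfl⟩, fun t => by simpa using tendsto_const_nhds⟩

lemma single_mem_smallAtInfinity (k : H) : Pi.single k (1 : ℂ) ∈ SmallAtInfinity H := by
  have h : Tendsto (Pi.single k (1 : ℂ) : H → ℂ) cofinite (𝓝 0) := by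
    refine tendsto_const_nhds.congr' ?_
    filter_upwards [(Set.finite_singleton k).compl_mem_cofinite] with x hx
    rw [Pi.single_eq_of_ne hx]
  rw [mem_smallAtInfinity_iff]
  refine ⟨⟨1, fun x => ?_⟩, fun t => ?_⟩
  · by_cases hx : x = k
    · simp [hx]
    · simp [Pi.single_eq_of_ne hx]
  · simpa using (h.comp (mul_left_injective t).tendsto_cofinite).sub h

lemma sum_single_mem_smallAtInfinity (K : Finset H) (a : H → ℂ) :
    ∑ k ∈ K, a k • Pi.single k (1 : ℂ) ∈ SmallAtInfinity H := by
  induction K using Finset.induction_on with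
  | empty => exact const_mem_smallAtInfinity 0
  | insert k K hk ih =>
    rw [Finset.sum_insert hk]
    exact smallAtInfinity_add (smallAtInfinity_smul (single_mem_smallAtInfinity k) _) ih

omit [Group H] in
lemma sum_single_apply (K : Finset H) (a : H → ℂ) (x : H) :
    (∑ k ∈ K, a k • Pi.single k (1 : ℂ) : H → ℂ) x = if x ∈ K then a x else 0 := by
  simp [Finset.sum_apply, Pi.single_apply]

namespace IsLeftInvariantState

variable {φ : (H → ℂ) → ℂ} (hφ : IsLeftInvariantState (SmallAtInfinity H) φ)
include hφ

lemma map_single (k : H) : φ (Pi.single k 1) = φ (Pi.single 1 1) := by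
  rw [← hφ.map_translate k _ (single_mem_smallAtInfinity 1)]
  congr 1
  ext x
  simp [Pi.single_apply, inv_mul_eq_one, eq_comm]

lemma map_sum_single (K : Finset H) (a : H → ℂ) :
    φ (∑ k ∈ K, a k • Pi.single k (1 : ℂ)) = (∑ k ∈ K, a k) * φ (Pi.single 1 1) := by
  induction K using Finset.induction_on with
  | empty =>
    have := hφ.map_smul 0 _ (const_mem_smallAtInfinity 1)
    rw [zero_smul, zero_mul] at this
    simpa using this
  | insert k K hk ih =>
    rw [Finset.sum_insert hk, Finset.sum_insert hk,
      hφ.map_add _ (smallAtInfinity_smul (single_mem_smallAtInfinity k) _) _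
        (sum_single_mem_smallAtInfinity K a), ih,
      hφ.map_smul _ _ (single_mem_smallAtInfinity k), hφ.map_single, add_mul]

lemma map_single_eq_zero [Infinite H] : φ (Pi.single 1 1) = 0 := by
  have h0 := hφ.nonneg _ (single_mem_smallAtInfinity 1) fun x => by
    by_cases hx : x = 1
    · simp [hx]
    · simp [Pi.single_eq_of_ne hx]
  refine Complex.ext (le_antisymm ?_ h0.1) h0.2
  by_contra! hpos
  rw [Complex.zero_re] at hpos
  obtain ⟨n, hn⟩ := exists_nat_gt (1 / (φ (Pi.single 1 1)).re)
  obtain ⟨K, hK⟩ := Infinite.exists_subset_card_eq H n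
  have h1 := (hφ.nonneg _ (smallAtInfinity_add (const_mem_smallAtInfinity 1)
    (sum_single_mem_smallAtInfinity K fun _ => -1)) fun x => by
      rw [Pi.add_apply, sum_single_apply]
      split_ifs <;> simp).1
  rw [hφ.map_add _ (const_mem_smallAtInfinity 1) _ (sum_single_mem_smallAtInfinity K _),
    hφ.map_sum_single, hφ.map_one] at h1
  simp only [Finset.sum_const, hK, Complex.add_re, Complex.one_re, nsmul_eq_mul, mul_neg, mul_one,
    neg_mul, Complex.neg_re, Complex.mul_re, Complex.natCast_re, Complex.natCast_im, zero_mul,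
    sub_zero] at h1
  rw [div_lt_iff₀ hpos] at hn
  linarith

lemma map_const (c : ℂ) : φ (fun _ => c) = c := by
  have := hφ.map_smul c _ (const_mem_smallAtInfinity 1)
  rw [hφ.map_one, mul_one] at this
  convert this using 2
  ext
  simp

lemma re_nonneg_of_eventually [Infinite H] {f : H → ℂ} (hf : f ∈ SmallAtInfinity H)
    (him : ∀ x, (f x).im = 0) (hre : ∀ᶠ x in cofinite, 0 ≤ (f x).re) :
    0 ≤ (φ f).re ∧ (φ f).im = 0 := by
  rw [eventually_cofinite] at hre
  have hK := sum_single_mem_smallAtInfinity hre.toFinset fun x => ((|(f x).re| : ℝ) : ℂ)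
  have h := hφ.nonneg _ (smallAtInfinity_add hf hK) fun x => by
    rw [Pi.add_apply, sum_single_apply]
    split_ifs with hx
    · simp [him, neg_le_iff_add_nonneg.1 (neg_le.1 (neg_le_abs (f x).re))]
    · simpa [him] using hx
  rwa [hφ.map_add _ hf _ hK, hφ.map_sum_single, hφ.map_single_eq_zero, mul_zero, add_zero] at h

lemma im_eq_zero [Infinite H] {f : H → ℂ} (hf : f ∈ SmallAtInfinity H)
    (him : ∀ x, (f x).im = 0) : (φ f).im = 0 := by
  obtain ⟨C, hC⟩ := hf.1
  have h := hφ.nonneg _ (smallAtInfinity_add hf (const_mem_smallAtInfinity (C : ℂ))) fun x => by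
    have := neg_le_of_abs_le ((Complex.abs_re_le_norm _).trans (hC x))
    simp only [Pi.add_apply, Complex.add_re, Complex.ofReal_re, Complex.add_im, him,
      Complex.ofReal_im, add_zero, and_true]
    linarith
  rw [hφ.map_add _ hf _ (const_mem_smallAtInfinity _), hφ.map_const] at h
  simpa using h.2

lemma re_le_of_eventually [Infinite H] {f : H → ℂ} (hf : f ∈ SmallAtInfinity H) {C : ℝ}
    (h : ∀ᶠ x in cofinite, (f x).re ≤ C) : (φ f).re ≤ C := by
  set u : H → ℂ := fun x => ((f x).re : ℂ) with hu
  set v : H → ℂ := fun x => ((f x).im : ℂ) with hv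
  have hum : u ∈ SmallAtInfinity H :=
    smallAtInfinity_comp hf (Complex.ofRealCLM.comp Complex.reCLM)
  have hvm : v ∈ SmallAtInfinity H :=
    smallAtInfinity_comp hf (Complex.ofRealCLM.comp Complex.imCLM)
  have hfuv : f = u + Complex.I • v := by
    ext x
    simp [hu, hv, mul_comm Complex.I, Complex.re_add_im]
  have him : (φ v).im = 0 := hφ.im_eq_zero hvm fun x => by simp [hv]
  have hre : (φ f).re = (φ u).re := by
    rw [hfuv, hφ.map_add _ hum _ (smallAtInfinity_smul hvm _), hφ.map_smul _ _ hvm]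
    simp [him]
  have h1 := (hφ.re_nonneg_of_eventually
    (smallAtInfinity_add (const_mem_smallAtInfinity (C : ℂ)) (smallAtInfinity_smul hum (-1)))
    (fun x => by simp [hu]) (h.mono fun x hx => by simpa [hu] using hx)).1
  rw [hφ.map_add _ (const_mem_smallAtInfinity _) _ (smallAtInfinity_smul hum _), hφ.map_const,
    hφ.map_smul _ _ hum] at h1
  simp at h1
  rw [hre]
  linarith

lemma norm_le_of_eventually [Infinite H] {f : H → ℂ} (hf : f ∈ SmallAtInfinity H) {C : ℝ}
    (h : ∀ᶠ x in cofinite, ‖f x‖ ≤ C) : ‖φ f‖ ≤ C := by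
  obtain ⟨c, hc, hcf⟩ : ∃ c : ℂ, ‖c‖ = 1 ∧ c * φ f = (‖φ f‖ : ℂ) := by
    by_cases hz : φ f = 0
    · exact ⟨1, by simp, by simp [hz]⟩
    · have hz' : (‖φ f‖ : ℂ) ≠ 0 := by simpa using hz
      refine ⟨(‖φ f‖ : ℂ) / φ f, by simp [hz], by field_simp⟩
  have h1 := hφ.re_le_of_eventually (smallAtInfinity_smul hf c) (C := C) (h.mono fun x hx => by
    refine (Complex.re_le_norm _).trans ?_
    simpa [hc] using hx)
  rwa [hφ.map_smul _ _ hf, hcf, Complex.ofReal_re] at h1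

end IsLeftInvariantState

/-- A sequence of bounded positive functionals on `ℓ∞(H)` whose masses stay away from `0` and which
are asymptotically left invariant yields an invariant state. -/
lemma amenableGroup_of_asymptotic (ψ : ℕ → (H → ℂ) → ℂ)
    (hadd : ∀ n, ∀ f ∈ BddFuns H, ∀ g ∈ BddFuns H, ψ n (f + g) = ψ n f + ψ n g)
    (hsmul : ∀ n, ∀ (c : ℂ), ∀ f ∈ BddFuns H, ψ n (c • f) = c * ψ n f)
    (hpos : ∀ n, ∀ f ∈ BddFuns H, (∀ x, 0 ≤ f x) → 0 ≤ ψ n f)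
    (hbdd : ∀ f ∈ BddFuns H, ∃ C, ∀ n, ‖ψ n f‖ ≤ C)
    {c : ℝ} (hc : 0 < c) (hmass : ∀ n, c ≤ (ψ n fun _ => 1).re)
    (hinv : ∀ t : H, ∀ f ∈ BddFuns H,
      Tendsto (fun n => ψ n (fun s => f (t⁻¹ * s)) - ψ n f) atTop (𝓝 0)) :
    AmenableGroup H := by
  have hlim : ∀ f ∈ BddFuns H, ∃ z, Tendsto (fun n => ψ n f) (hyperfilter ℕ : Filter ℕ) (𝓝 z) := by
    intro f hf
    obtain ⟨C, hC⟩ := hbdd f hf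
    obtain ⟨z, -, hz⟩ := (isCompact_closedBall (0 : ℂ) C).ultrafilter_le_nhds
      ((hyperfilter ℕ).map fun n => ψ n f) (by
        rw [le_principal_iff, Ultrafilter.mem_coe, Ultrafilter.mem_map]
        exact Filter.univ_mem' fun n => by simpa using hC n)
    exact ⟨z, hz⟩
  set Ψ : (H → ℂ) → ℂ := fun f => limUnder (hyperfilter ℕ : Filter ℕ) fun n => ψ n f
  have hΨ : ∀ f ∈ BddFuns H, Tendsto (fun n => ψ n f) (hyperfilter ℕ : Filter ℕ) (𝓝 (Ψ f)) :=
    fun f hf => tendsto_nhds_limUnder (hlim f hf)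
  have hone : (fun _ : H => (1 : ℂ)) ∈ BddFuns H := ⟨1, by simp⟩
  have hΨpos : ∀ f ∈ BddFuns H, (∀ x, 0 ≤ f x) → 0 ≤ Ψ f := fun f hf h =>
    ge_of_tendsto' (hΨ f hf) fun n => hpos n f hf h
  have hΨone : c ≤ (Ψ fun _ => 1).re :=
    ge_of_tendsto' ((Complex.continuous_re.tendsto _).comp (hΨ _ hone)) hmass
  have hne : (Ψ fun _ => 1) ≠ 0 := fun h => by
    rw [h, Complex.zero_re] at hΨone
    linarith
  refine ⟨fun f => Ψ f / Ψ fun _ => 1, div_self hne, fun f hf g hg => ?_, fun a f hf => ?_,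
    fun f hf h => ?_, fun t f hf => ?_⟩
  · beta_reduce
    rw [← add_div]
    congr 1
    refine tendsto_nhds_unique (hΨ _ (bddFuns_add hf hg)) ?_
    exact ((hΨ f hf).add (hΨ g hg)).congr fun n => (hadd n f hf g hg).symm
  · beta_reduce
    rw [← mul_div_assoc]
    congr 1
    obtain ⟨C, hC⟩ := hf
    have haf : a • f ∈ BddFuns H := ⟨‖a‖ * C, fun x => by
      rw [Pi.smul_apply, norm_smul]
      exact mul_le_mul_of_nonneg_left (hC x) (norm_nonneg _)⟩
    refine tendsto_nhds_unique (hΨ _ haf) ?_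
    exact ((hΨ f ⟨C, hC⟩).const_mul a).congr fun n => (hsmul n a f ⟨C, hC⟩).symm
  · have h1 : 0 ≤ Ψ f := hΨpos f hf fun x => Complex.le_def.2 ⟨(h x).1, (h x).2.symm⟩
    have h2 : 0 ≤ Ψ fun _ => 1 := hΨpos _ hone fun _ => zero_le_one
    have h3 : 0 ≤ Ψ f / Ψ fun _ => 1 := by
      rw [div_eq_mul_inv]
      exact mul_nonneg h1 (inv_nonneg_of_nonneg h2)
    exact ⟨(Complex.le_def.1 h3).1, (Complex.le_def.1 h3).2.symm⟩
  · beta_reduce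
    congr 1
    obtain ⟨C, hC⟩ := hf
    have ht : (fun s => f (t⁻¹ * s)) ∈ BddFuns H := ⟨C, fun s => hC _⟩
    have h1 := (hinv t f ⟨C, hC⟩).mono_left Nat.hyperfilter_le_atTop
    exact sub_eq_zero.1 (tendsto_nhds_unique ((hΨ _ ht).sub (hΨ f ⟨C, hC⟩)) h1)

end State

section Exhaustion

lemma exists_exhaustion (X : Type*) [Countable X] :
    ∃ S : ℕ → Finset X, ∀ x, ∀ᶠ n in atTop, x ∈ S n := by
  obtain ⟨f, hf⟩ := exists_injective_nat X
  refine ⟨fun n => ((Set.finite_Iic n).preimage hf.injOn).toFinset, fun x => ?_⟩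
  filter_upwards [eventually_ge_atTop (f x)] with n hn
  simpa using hn

/-- An exhaustion by finite sets, containing prescribed finite sets, such that each of countably
many maps sends almost every term into the next one. -/
lemma exists_chain {X J : Type*} [Countable X] [Countable J] (κ : J → X → X)
    (A : ℕ → Finset X) :
    ∃ E : ℕ → Finset X, Monotone E ∧ (∀ x, ∃ i, x ∈ E i) ∧ (∀ n, A n ⊆ E n) ∧
      ∀ j, ∀ᶠ i in atTop, ∀ x ∈ E i, κ j x ∈ E (i + 1) := by
  obtain ⟨S, hS⟩ := exists_exhaustion X
  obtain ⟨T, hT⟩ := exists_exhaustion J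
  let E : ℕ → Finset X := fun n => Nat.rec (A 0 ∪ S 0) (fun n K =>
    (A (n + 1) ∪ S (n + 1)) ∪ (K ∪ (T n ×ˢ K).image fun p => κ p.1 p.2)) n
  have hE : ∀ n, E (n + 1)
    = (A (n + 1) ∪ S (n + 1)) ∪ (E n ∪ (T n ×ˢ E n).image fun p => κ p.1 p.2) := fun _ => rfl
  have hAS : ∀ n, A n ∪ S n ⊆ E n := by
    rintro (_ | n)
    · exact subset_rfl
    · rw [hE]
      exact Finset.subset_union_left
  refine ⟨E, monotone_nat_of_le_succ fun n => ?_, fun x => ?_,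
    fun n => Finset.subset_union_left.trans (hAS n), fun j => ?_⟩
  · rw [hE]
    exact Finset.subset_union_left.trans Finset.subset_union_right
  · obtain ⟨n, hn⟩ := (hS x).exists
    exact ⟨n, hAS n (Finset.mem_union_right _ hn)⟩
  · filter_upwards [hT j] with i hi x hx
    rw [hE]
    refine Finset.mem_union_right _ (Finset.mem_union_right _ ?_)
    exact Finset.mem_image.2 ⟨(j, x), Finset.mk_mem_product hi hx, rfl⟩

/-- A proper function that varies by at most one under each translation, outside a finite set, and
that grows as slowly as prescribed by the finite sets `A n`. -/
lemma exists_slow {G : Type*} [Group G] [Countable G] (A : ℕ → Finset G) :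
    ∃ ρ : G → ℕ, Tendsto ρ cofinite atTop ∧
      (∀ t, ∀ᶠ g in cofinite, ρ (g * t) ≤ ρ g + 1 ∧ ρ g ≤ ρ (g * t) + 1) ∧
      (∀ t, ∀ᶠ g in cofinite, ρ (t * g) ≤ ρ g + 1 ∧ ρ g ≤ ρ (t * g) + 1) ∧
      ∀ᶠ g in cofinite, g ∉ A (ρ g) := by
  obtain ⟨L, hmono, hex, hA, hκ⟩ := exists_chain (J := G ⊕ G)
    (Sum.elim (fun t g => g * t) (fun t g => t * g)) (fun n => A (n + 1))
  set ρ : G → ℕ := fun g => Nat.find (hex g) with hρ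
  have hmem : ∀ g, g ∈ L (ρ g) := fun g => Nat.find_spec (hex g)
  have hle : ∀ g n, g ∈ L n → ρ g ≤ n := fun g n h => Nat.find_min' (hex g) h
  have hprop : Tendsto ρ cofinite atTop := by
    refine tendsto_atTop.2 fun n => ?_
    rw [eventually_cofinite]
    refine (L n).finite_toSet.subset fun g hg => ?_
    exact hmono (not_le.1 hg).le (hmem g)
  have hR : ∀ t, ∀ᶠ g in cofinite, ρ (g * t) ≤ ρ g + 1 := fun t => by
    filter_upwards [hprop.eventually (hκ (Sum.inl t))] with g hg
    exact hle _ _ (hg g (hmem g))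
  have hL : ∀ t, ∀ᶠ g in cofinite, ρ (t * g) ≤ ρ g + 1 := fun t => by
    filter_upwards [hprop.eventually (hκ (Sum.inr t))] with g hg
    exact hle _ _ (hg g (hmem g))
  refine ⟨ρ, hprop, fun t => ?_, fun t => ?_, ?_⟩
  · filter_upwards [hR t, (mul_left_injective t).tendsto_cofinite.eventually (hR t⁻¹)]
      with g h1 h2
    exact ⟨h1, by simpa using h2⟩
  · filter_upwards [hL t, (mul_right_injective t).tendsto_cofinite.eventually (hL t⁻¹)]
      with g h1 h2
    exact ⟨h1, by simpa using h2⟩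
  · filter_upwards [hprop.eventually (eventually_ge_atTop 1)] with g hg hgA
    have h1 : g ∈ L (ρ g - 1) := hA _ (by rwa [Nat.sub_add_cancel hg])
    have := hle _ _ h1
    omega

end Exhaustion

section Cesaro

variable {a : ℕ → ℂ} {C : ℝ}

lemma norm_cesaro_le (hC : 0 ≤ C) (ha : ∀ i, ‖a i‖ ≤ C) (N : ℕ) :
    ‖(∑ i ∈ Finset.range N, a i) / N‖ ≤ C := by
  rw [norm_div, Complex.norm_natCast]
  refine div_le_of_le_mul₀ (by positivity) hC ?_
  refine (norm_sum_le_of_le _ fun i _ => ha i).trans ?_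
  simp [mul_comm]

lemma norm_cesaro_succ_sub_le (hC : 0 ≤ C) (ha : ∀ i, ‖a i‖ ≤ C) {N : ℕ} (hN : 0 < N) :
    ‖(∑ i ∈ Finset.range (N + 1), a i) / (N + 1 : ℕ) - (∑ i ∈ Finset.range N, a i) / N‖
      ≤ 2 * C / (N + 1 : ℕ) := by
  have h1 : (N : ℂ) ≠ 0 := by exact_mod_cast hN.ne'
  have h2 : ((N + 1 : ℕ) : ℂ) ≠ 0 := by exact_mod_cast N.succ_ne_zero
  have e : (∑ i ∈ Finset.range (N + 1), a i) / (N + 1 : ℕ) - (∑ i ∈ Finset.range N, a i) / N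
      = (a N - (∑ i ∈ Finset.range N, a i) / N) / (N + 1 : ℕ) := by
    rw [Finset.sum_range_succ]
    field_simp
    push_cast
    ring
  rw [e, norm_div, Complex.norm_natCast]
  gcongr
  rw [two_mul]
  exact (norm_sub_le _ _).trans (add_le_add (ha N) (norm_cesaro_le hC ha N))

lemma norm_cesaro_sub_le (hC : 0 ≤ C) (ha : ∀ i, ‖a i‖ ≤ C) {N N' : ℕ} (hN : 0 < N)
    (hN' : 0 < N') (h1 : N' ≤ N + 1) (h2 : N ≤ N' + 1) :
    ‖(∑ i ∈ Finset.range N', a i) / N' - (∑ i ∈ Finset.range N, a i) / N‖ ≤ 2 * C / N := by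
  rcases (by omega : N' = N ∨ N' = N + 1 ∨ N = N' + 1) with rfl | rfl | rfl
  · simp only [sub_self, norm_zero]
    positivity
  · refine (norm_cesaro_succ_sub_le hC ha hN).trans ?_
    gcongr
    omega
  · rw [norm_sub_rev]
    exact norm_cesaro_succ_sub_le hC ha hN'

lemma sum_range_two_step_le {u : ℕ → ℝ} {B : ℝ} (hu : ∀ i, u i - u 0 ≤ B) (N : ℕ) :
    ∑ i ∈ Finset.range N, (u (i + 1) - u (i - 1)) ≤ 2 * B := by
  have h : ∀ N, ∑ i ∈ Finset.range N, (u (i + 1) - u (i - 1))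
      = (u N - u 0) + (u (N - 1) - u 0) := by
    intro N
    induction N with
    | zero => simp
    | succ N ih =>
      rw [Finset.sum_range_succ, ih, Nat.add_sub_cancel]
      ring
  rw [h]
  linarith [hu N, hu (N - 1)]

end Cesaro

section Mixed

variable {X : Type*}

/-- The average over the first `N` truncations of the damped measures at scale `R`. -/
noncomputable def scaleAverage (E : ℕ → Finset X) (R : ℝ) (N : ℕ) (F : X → ℂ)
    (v : SqSummable X) : ℂ :=
  (∑ i ∈ Finset.range N, damped R F (trunc (E i) v)) / N

/-- The damped measure of `v` at scale `N`, completed by the missing mass times the average of the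
damped measures of its truncations at scale `R`. -/
noncomputable def mixed (E : ℕ → Finset X) (R : ℝ) (N : ℕ) (F : X → ℂ) (v : SqSummable X) : ℂ :=
  damped N F v + ((1 - dampedMass N v : ℝ) : ℂ) * scaleAverage E R N F v

variable {E E' : ℕ → Finset X} {R : ℝ} {N N' : ℕ} {F F' : X → ℂ} {C C' : ℝ}

lemma mixed_add (hF : ∀ x, ‖F x‖ ≤ C) (hF' : ∀ x, ‖F' x‖ ≤ C') (v : SqSummable X) :
    mixed E R N (F + F') v = mixed E R N F v + mixed E R N F' v := by
  simp only [mixed, scaleAverage, damped_add hF hF', Finset.sum_add_distrib]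
  ring

lemma mixed_const_smul (c : ℂ) (F : X → ℂ) (v : SqSummable X) :
    mixed E R N (c • F) v = c * mixed E R N F v := by
  simp only [mixed, scaleAverage, damped_const_smul, ← Finset.mul_sum]
  ring

lemma mixed_nonneg (hF : ∀ x, 0 ≤ F x) (v : SqSummable X) : 0 ≤ mixed E R N F v := by
  refine add_nonneg (damped_nonneg hF v) (mul_nonneg ?_ ?_)
  · exact_mod_cast sub_nonneg.2 (dampedMass_le_one _ v)
  · rw [scaleAverage, div_eq_mul_inv]
    refine mul_nonneg (Finset.sum_nonneg fun i _ => damped_nonneg hF _) ?_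
    exact inv_nonneg_of_nonneg (by exact_mod_cast N.zero_le)

lemma norm_one_sub_dampedMass_le (S : ℝ) (v : SqSummable X) :
    ‖((1 - dampedMass S v : ℝ) : ℂ)‖ ≤ 1 := by
  rw [Complex.norm_real, Real.norm_of_nonneg (sub_nonneg.2 (dampedMass_le_one _ v))]
  linarith [dampedMass_nonneg S v]

lemma norm_scaleAverage_le (hC : 0 ≤ C) (hF : ∀ x, ‖F x‖ ≤ C) (v : SqSummable X) :
    ‖scaleAverage E R N F v‖ ≤ C :=
  norm_cesaro_le hC (fun _ => norm_damped_le hC hF _) N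

lemma norm_mixed_le (hC : 0 ≤ C) (hF : ∀ x, ‖F x‖ ≤ C) (v : SqSummable X) :
    ‖mixed E R N F v‖ ≤ 2 * C := by
  refine (norm_add_le _ _).trans ?_
  rw [norm_mul]
  have h1 := norm_damped_le (R := N) hC hF v
  have h2 := mul_le_mul (norm_one_sub_dampedMass_le N v)
    (norm_scaleAverage_le (E := E) (R := R) (N := N) hC hF v) (norm_nonneg _) zero_le_one
  linarith

lemma mixed_comp_permute (e : X ≃ X) (v : SqSummable X) :
    mixed E R N (F ∘ e) v
      = mixed (fun i => (E i).map e.toEmbedding) R N F (permute e v) := by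
  simp only [mixed, scaleAverage, ← damped_permute, permute_trunc, dampedMass, norm_permute]

lemma scaleAverage_one (v : SqSummable X) : scaleAverage E R N (fun _ => 1) v
    = (((∑ i ∈ Finset.range N, dampedMass R (trunc (E i) v)) / N : ℝ) : ℂ) := by
  simp only [scaleAverage, damped_one]
  push_cast
  rfl

lemma scaleAverage_one_re_le_mixed (v : SqSummable X) :
    (scaleAverage E R N (fun _ => 1) v).re ≤ (mixed E R N (fun _ => 1) v).re := by
  have h1 : (scaleAverage E R N (fun _ => 1) v).re ≤ 1 :=
    (Complex.re_le_norm _).trans (norm_scaleAverage_le zero_le_one (by simp) v)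
  rw [mixed, damped_one, Complex.add_re, Complex.ofReal_re, Complex.re_ofReal_mul]
  nlinarith [dampedMass_nonneg (N : ℝ) v]

lemma norm_mixed_sub_le (hN : 0 < N) (hN' : 0 < N') (h1 : N' ≤ N + 1) (h2 : N ≤ N' + 1)
    (hC : 0 ≤ C) (hF : ∀ x, ‖F x‖ ≤ C) (v w : SqSummable X) :
    ‖mixed E R N' F v - mixed E' R N F w‖ ≤ (8 * C * (‖v - w‖ + 1) + 2 * C) / N
      + (1 - dampedMass N w) * ((∑ i ∈ Finset.range N,
          ‖damped R F (trunc (E i) v) - damped R F (trunc (E' i) w)‖) / N) := by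
  have hNr : (0 : ℝ) < N := by exact_mod_cast hN
  have hNr' : (0 : ℝ) < N' := by exact_mod_cast hN'
  have habs : |(N : ℝ) - N'| ≤ 1 := by
    have h1' : (N' : ℝ) ≤ N + 1 := by exact_mod_cast h1
    have h2' : (N : ℝ) ≤ N' + 1 := by exact_mod_cast h2
    rw [abs_le]
    constructor <;> linarith
  have hδ : ‖w - v‖ + |(N : ℝ) - N'| ≤ ‖v - w‖ + 1 := by
    rw [norm_sub_rev]
    linarith
  have d1 : ‖damped N' F v - damped N F w‖ ≤ 4 * C * (‖v - w‖ + 1) / N := by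
    rw [norm_sub_rev]
    refine (norm_damped_sub_le hNr hNr' hC hF w v).trans ?_
    gcongr
  have d2 : ‖((1 - dampedMass N' v : ℝ) : ℂ) - ((1 - dampedMass N w : ℝ) : ℂ)‖
      ≤ 4 * (‖v - w‖ + 1) / N := by
    have h := norm_damped_sub_le (F := fun _ => 1) hNr hNr' zero_le_one (by simp) w v
    rw [damped_one, damped_one] at h
    have e : ((1 - dampedMass N' v : ℝ) : ℂ) - ((1 - dampedMass N w : ℝ) : ℂ)
        = (dampedMass N w : ℂ) - (dampedMass N' v : ℂ) := by
      push_cast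
      ring
    rw [e]
    refine h.trans ?_
    rw [mul_one]
    gcongr
  have d3 : ‖scaleAverage E R N' F v - scaleAverage E R N F v‖ ≤ 2 * C / N :=
    norm_cesaro_sub_le hC (fun _ => norm_damped_le hC hF _) hN hN' h1 h2
  have d4 : ‖scaleAverage E R N F v - scaleAverage E' R N F w‖
      ≤ (∑ i ∈ Finset.range N,
          ‖damped R F (trunc (E i) v) - damped R F (trunc (E' i) w)‖) / N := by
    rw [scaleAverage, scaleAverage, ← sub_div, ← Finset.sum_sub_distrib, norm_div,
      Complex.norm_natCast]
    gcongr
    exact norm_sum_le _ _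
  have e : mixed E R N' F v - mixed E' R N F w = (damped N' F v - damped N F w)
      + (((1 - dampedMass N' v : ℝ) : ℂ) - ((1 - dampedMass N w : ℝ) : ℂ))
        * scaleAverage E R N' F v
      + ((1 - dampedMass N w : ℝ) : ℂ) * (scaleAverage E R N' F v - scaleAverage E R N F v)
      + ((1 - dampedMass N w : ℝ) : ℂ)
        * (scaleAverage E R N F v - scaleAverage E' R N F w) := by
    rw [mixed, mixed]
    ring
  have hm : 0 ≤ 1 - dampedMass N w := sub_nonneg.2 (dampedMass_le_one _ w)
  rw [e]
  calc _ ≤ 4 * C * (‖v - w‖ + 1) / N + 4 * (‖v - w‖ + 1) / N * C + 1 * (2 * C / N)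
        + (1 - dampedMass N w) * ((∑ i ∈ Finset.range N,
          ‖damped R F (trunc (E i) v) - damped R F (trunc (E' i) w)‖) / N) := by
        refine norm_add_le_of_le (norm_add_le_of_le (norm_add_le_of_le d1 ?_) ?_) ?_
        · rw [norm_mul]
          exact mul_le_mul d2 (norm_scaleAverage_le hC hF v) (norm_nonneg _) (by positivity)
        · rw [norm_mul]
          exact mul_le_mul (norm_one_sub_dampedMass_le _ w) d3 (norm_nonneg _) zero_le_one
        · rw [norm_mul, Complex.norm_real, Real.norm_of_nonneg hm]
          exact mul_le_mul_of_nonneg_left d4 hm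
    _ = _ := by ring

lemma one_sub_dampedMass_mul_log_le (hR : 1 ≤ R) (hN : 0 < N) (w : SqSummable X) :
    (1 - dampedMass N w) * (Real.log (R ^ 2 + ‖w‖ ^ 2) - Real.log (R ^ 2))
      ≤ 2 * Real.log N + 1 := by
  have hN1 : (1 : ℝ) ≤ N := by exact_mod_cast hN
  set y := ‖w‖ ^ 2 with hy
  have hy0 : 0 ≤ y := by positivity
  have hNN : (1 : ℝ) ≤ (N : ℝ) ^ 2 := one_le_pow₀ hN1
  have hRR : (1 : ℝ) ≤ R ^ 2 := one_le_pow₀ hR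
  have hm : 1 - dampedMass N w = (N : ℝ) ^ 2 / ((N : ℝ) ^ 2 + y) := by
    rw [dampedMass, ← hy]
    field_simp
    ring
  have hlog : Real.log (R ^ 2 + y) - Real.log (R ^ 2) ≤ 2 * Real.log N + y / (N : ℝ) ^ 2 := by
    rw [← Real.log_div (by positivity) (by positivity)]
    calc _ ≤ Real.log ((N : ℝ) ^ 2 * (1 + y / (N : ℝ) ^ 2)) := by
          refine Real.log_le_log (by positivity) ?_
          rw [mul_add, mul_div_cancel₀ _ (by positivity), add_div, div_self (by positivity)]
          have : y / R ^ 2 ≤ y := div_le_self hy0 hRR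
          linarith
      _ = 2 * Real.log N + Real.log (1 + y / (N : ℝ) ^ 2) := by
          rw [Real.log_mul (by positivity) (by positivity), Real.log_pow]
          norm_num
      _ ≤ _ := by
          have := Real.log_le_sub_one_of_pos (by positivity : 0 < 1 + y / (N : ℝ) ^ 2)
          linarith
  have hlogN : 0 ≤ Real.log N := Real.log_nonneg hN1
  have hle : (N : ℝ) ^ 2 / ((N : ℝ) ^ 2 + y) ≤ 1 := div_le_one_of_le₀ (by linarith) (by positivity)
  rw [hm]
  calc _ ≤ (N : ℝ) ^ 2 / ((N : ℝ) ^ 2 + y) * (2 * Real.log N + y / (N : ℝ) ^ 2) := by gcongr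
    _ = (N : ℝ) ^ 2 / ((N : ℝ) ^ 2 + y) * (2 * Real.log N) + y / ((N : ℝ) ^ 2 + y) := by
        field_simp
    _ ≤ 1 * (2 * Real.log N) + 1 := by
        gcongr
        exact div_le_one_of_le₀ (by linarith) (by positivity)
    _ = _ := by ring

end Mixed

section Estimates

variable {X : Type*} {E E' : ℕ → Finset X} {R C : ℝ} {F : X → ℂ}

lemma norm_mixed_sub_le_of_trunc (hR : 0 < R) (hE : Monotone E) {n n' : ℕ} (h1 : n' ≤ n + 1)
    (h2 : n ≤ n' + 1) (hC : 0 ≤ C) (hF : ∀ x, ‖F x‖ ≤ C) (v w : SqSummable X) :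
    ‖mixed E R (n' + 1) F v - mixed E R (n + 1) F w‖
      ≤ (8 * C * (‖v - w‖ + 1) + 2 * C) / (n + 1 : ℕ) + 4 * C * ‖trunc (E n) (v - w)‖ / R := by
  refine (norm_mixed_sub_le n.succ_pos n'.succ_pos (by omega) (by omega) hC hF v w).trans ?_
  gcongr
  refine (mul_le_of_le_one_left (by positivity)
    (by linarith [dampedMass_nonneg (n + 1 : ℕ) w])).trans ?_
  rw [div_le_iff₀ (by positivity), mul_comm, ← nsmul_eq_mul]
  refine (Finset.sum_le_card_nsmul _ _ _ fun i hi => ?_).trans_eq (by rw [Finset.card_range])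
  have h := norm_damped_sub_le hR hR hC hF (trunc (E i) v) (trunc (E i) w)
  rw [sub_self, abs_zero, add_zero, ← trunc_sub] at h
  refine h.trans ?_
  gcongr
  exact norm_trunc_mono (hE (Nat.lt_succ_iff.1 (Finset.mem_range.1 hi))) _

lemma norm_mixed_sub_le_of_shift (hR : 1 ≤ R) (hE : Monotone E) {N N' i₀ : ℕ}
    (hi₀ : ∀ i ≥ i₀, E' i ⊆ E (i + 1) ∧ E (i - 1) ⊆ E' i) (hN : 0 < N) (hN' : 0 < N')
    (h1 : N' ≤ N + 1) (h2 : N ≤ N' + 1) (hC : 0 ≤ C) (hF : ∀ x, ‖F x‖ ≤ C)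
    (v w : SqSummable X) :
    ‖mixed E R N' F v - mixed E' R N F w‖ ≤ (8 * C * (‖v - w‖ + 1) + 2 * C) / N
      + (4 * C * ‖v - w‖ / R + 8 * C * (2 * Real.log N + 1) / N + 2 * C * i₀ / N) := by
  refine (norm_mixed_sub_le hN hN' h1 h2 hC hF v w).trans ?_
  gcongr
  have hR0 : 0 < R := by linarith
  have hNr : (0 : ℝ) < N := by exact_mod_cast hN
  set u : ℕ → ℝ := fun i => Real.log (R ^ 2 + ‖trunc (E i) w‖ ^ 2) with hu
  have hlog : ∀ {S T : Finset X}, S ⊆ T → Real.log (R ^ 2 + ‖trunc S w‖ ^ 2)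
      ≤ Real.log (R ^ 2 + ‖trunc T w‖ ^ 2) := fun {S T} h =>
    Real.log_le_log (by positivity) (by
      gcongr
      exact norm_trunc_mono h w)
  have hmono : Monotone u := fun i j hij => hlog (hE hij)
  set B := Real.log (R ^ 2 + ‖w‖ ^ 2) - Real.log (R ^ 2) with hB
  have huB : ∀ i, u i - u 0 ≤ B := fun i => by
    refine sub_le_sub (Real.log_le_log (by positivity) ?_) (Real.log_le_log (by positivity) ?_)
    · gcongr
      exact norm_trunc_le _ w
    · exact le_add_of_nonneg_right (by positivity)
  have hterm : ∀ i, ‖damped R F (trunc (E i) v) - damped R F (trunc (E' i) w)‖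
      ≤ 4 * C * ‖v - w‖ / R + 4 * C * (u (i + 1) - u (i - 1))
        + if i < i₀ then 2 * C else 0 := fun i => by
    have hstep : 0 ≤ u (i + 1) - u (i - 1) := sub_nonneg.2 (hmono (by omega))
    split_ifs with hi
    · have h3 := norm_sub_le_of_le (norm_damped_le (R := R) hC hF (trunc (E i) v))
        (norm_damped_le (R := R) hC hF (trunc (E' i) w))
      have h4 : 0 ≤ 4 * C * ‖v - w‖ / R + 4 * C * (u (i + 1) - u (i - 1)) := by positivity
      linarith
    · obtain ⟨hi1, hi2⟩ := hi₀ i (not_lt.1 hi)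
      have d1 : ‖damped R F (trunc (E i) v) - damped R F (trunc (E i) w)‖
          ≤ 4 * C * ‖v - w‖ / R := by
        refine (norm_damped_sub_le hR0 hR0 hC hF _ _).trans ?_
        rw [sub_self, abs_zero, add_zero, ← trunc_sub]
        gcongr
        exact norm_trunc_le _ _
      have d2 := norm_damped_sub_le_log hR0 hC hF (norm_trunc_apply_mono (hE i.le_succ) w)
      have d3 := norm_damped_sub_le_log hR0 hC hF (norm_trunc_apply_mono hi1 w)
      rw [norm_sub_rev] at d3
      have d4 := norm_sub_le_norm_sub_add_norm_sub (damped R F (trunc (E i) v))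
        (damped R F (trunc (E i) w)) (damped R F (trunc (E' i) w))
      have d5 := norm_sub_le_norm_sub_add_norm_sub (damped R F (trunc (E i) w))
        (damped R F (trunc (E (i + 1)) w)) (damped R F (trunc (E' i) w))
      have d6 : 2 * C * u (i - 1) ≤ 2 * C * u i := by
        gcongr
        exact hmono (by omega)
      have d7 : 2 * C * u (i - 1) ≤ 2 * C * Real.log (R ^ 2 + ‖trunc (E' i) w‖ ^ 2) := by
        gcongr
        exact hlog hi2
      rw [mul_sub] at d2 d3
      change _ ≤ 2 * C * u (i + 1) - 2 * C * u i at d2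
      change _ ≤ 2 * C * u (i + 1) - _ at d3
      linarith
  have hcount : ∑ i ∈ Finset.range N, (if i < i₀ then 2 * C else 0) ≤ 2 * C * i₀ := by
    rw [← Finset.sum_filter, Finset.sum_const, nsmul_eq_mul, mul_comm]
    gcongr
    refine (Finset.card_le_card (t := Finset.range i₀) fun i hi => ?_).trans_eq
      (Finset.card_range _)
    simpa using (Finset.mem_filter.1 hi).2
  have hsum : (∑ i ∈ Finset.range N,
      ‖damped R F (trunc (E i) v) - damped R F (trunc (E' i) w)‖) / N
      ≤ 4 * C * ‖v - w‖ / R + 8 * C * B / N + 2 * C * i₀ / N := by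
    rw [div_le_iff₀ hNr]
    calc _ ≤ _ := Finset.sum_le_sum fun i _ => hterm i
      _ ≤ N * (4 * C * ‖v - w‖ / R) + 4 * C * (2 * B) + 2 * C * i₀ := by
        rw [Finset.sum_add_distrib, Finset.sum_add_distrib, ← Finset.mul_sum, Finset.sum_const,
          Finset.card_range, nsmul_eq_mul]
        gcongr
        exact sum_range_two_step_le huB N
      _ = _ := by
        field_simp
        ring
  have hm0 : 0 ≤ 1 - dampedMass N w := sub_nonneg.2 (dampedMass_le_one _ w)
  have hm1 : 1 - dampedMass N w ≤ 1 := by linarith [dampedMass_nonneg N w]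
  calc _ ≤ (1 - dampedMass N w) * (4 * C * ‖v - w‖ / R + 8 * C * B / N + 2 * C * i₀ / N) := by
        gcongr
    _ = (1 - dampedMass N w) * (4 * C * ‖v - w‖ / R) + 8 * C * ((1 - dampedMass N w) * B) / N
        + (1 - dampedMass N w) * (2 * C * i₀ / N) := by ring
    _ ≤ 1 * (4 * C * ‖v - w‖ / R) + 8 * C * (2 * Real.log N + 1) / N + 1 * (2 * C * i₀ / N) := by
        gcongr
        exact one_sub_dampedMass_mul_log_le hR hN w
    _ = _ := by ring

lemma half_le_dampedMass (hR : 0 < R) {v : SqSummable X} (h : R ≤ ‖v‖) :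
    1 / 2 ≤ dampedMass R v := by
  rw [dampedMass, div_le_div_iff₀ (by norm_num) (by positivity)]
  nlinarith

lemma mass_le_mixed_add_mixed (hR : 0 < R) {N N' i₀ : ℕ} (hN : 0 < N) (hN' : 0 < N')
    (h1 : N' ≤ N + 1) (h2 : N ≤ N' + 1) {v w : SqSummable X}
    (hi₀ : ∀ i ≥ i₀, 2 * R ≤ ‖trunc (E i) v‖ + ‖trunc (E (i + 1)) w‖) :
    1 / 2 - (i₀ + 3) / N
      ≤ (mixed E R N' (fun _ => 1) v).re + (mixed E R N (fun _ => 1) w).re := by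
  have hNr : (0 : ℝ) < N := by exact_mod_cast hN
  have hterm : ∀ i, 1 / 2 - (if i < i₀ then 1 else 0)
      ≤ dampedMass R (trunc (E i) v) + dampedMass R (trunc (E (i + 1)) w) := fun i => by
    have m1 := dampedMass_nonneg R (trunc (E i) v)
    have m2 := dampedMass_nonneg R (trunc (E (i + 1)) w)
    split_ifs with hi
    · linarith
    · have h := hi₀ i (not_lt.1 hi)
      rcases le_or_gt R ‖trunc (E i) v‖ with h3 | h3
      · linarith [half_le_dampedMass hR h3]
      · linarith [half_le_dampedMass hR (by linarith : R ≤ ‖trunc (E (i + 1)) w‖)]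
  have hcount : ∑ i ∈ Finset.range N, (if i < i₀ then (1 : ℝ) else 0) ≤ i₀ := by
    rw [← Finset.sum_filter, Finset.sum_const, nsmul_eq_mul, mul_one, Nat.cast_le]
    refine (Finset.card_le_card (t := Finset.range i₀) fun i hi => ?_).trans_eq
      (Finset.card_range _)
    simpa using (Finset.mem_filter.1 hi).2
  have hshift : ∑ i ∈ Finset.range N, dampedMass R (trunc (E (i + 1)) w)
      ≤ ∑ i ∈ Finset.range N, dampedMass R (trunc (E i) w) + 1 := by
    have e1 := Finset.sum_range_succ (fun i => dampedMass R (trunc (E i) w)) N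
    have e2 := Finset.sum_range_succ' (fun i => dampedMass R (trunc (E i) w)) N
    linarith [dampedMass_nonneg R (trunc (E 0) w), dampedMass_le_one R (trunc (E N) w)]
  have hsum := Finset.sum_le_sum fun i (_ : i ∈ Finset.range N) => hterm i
  rw [Finset.sum_sub_distrib, Finset.sum_add_distrib, Finset.sum_const, Finset.card_range,
    nsmul_eq_mul] at hsum
  have havg : 1 / 2 - (i₀ + 1) / N ≤ (scaleAverage E R N (fun _ => 1) v).re
      + (scaleAverage E R N (fun _ => 1) w).re := by
    rw [scaleAverage_one, scaleAverage_one, Complex.ofReal_re, Complex.ofReal_re, ← add_div,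
      le_div_iff₀ hNr, sub_mul, div_mul_cancel₀ _ hNr.ne']
    linarith
  have hd : ‖scaleAverage E R N' (fun _ => 1) v - scaleAverage E R N (fun _ => 1) v‖
      ≤ 2 * 1 / N :=
    norm_cesaro_sub_le zero_le_one (fun _ => norm_damped_le zero_le_one (by simp) _) hN hN' h1 h2
  have hd' := neg_le_of_abs_le ((Complex.abs_re_le_norm _).trans hd)
  rw [Complex.sub_re] at hd'
  have e : ((i₀ : ℝ) + 3) / N = (i₀ + 1) / N + 2 * 1 / N := by ring
  rw [e]
  linarith [scaleAverage_one_re_le_mixed (E := E) (R := R) (N := N') v,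
    scaleAverage_one_re_le_mixed (E := E) (R := R) (N := N) w]

lemma tendsto_norm_trunc (hE : Monotone E) (hex : ∀ x, ∃ i, x ∈ E i) (v : SqSummable X) :
    Tendsto (fun i => ‖trunc (E i) v‖) atTop (𝓝 ‖v‖) := by
  have h := (hasSum_sq v).comp (hE.tendsto_atTop_finset hex)
  have h2 := (Real.continuous_sqrt.tendsto _).comp h
  rw [Real.sqrt_sq (norm_nonneg _)] at h2
  refine h2.congr fun i => ?_
  simp only [Function.comp_apply, ← norm_sq_trunc, Real.sqrt_sq (norm_nonneg _)]

end Estimates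

section Cocycle

variable {G : Type*} [Group G]

/-- Left translation of the first coordinate. -/
def shift (t : G) : G × ℕ ≃ G × ℕ := (Equiv.mulLeft t).prodCongr (Equiv.refl ℕ)

lemma shift_apply (t : G) (x : G × ℕ) : shift t x = (t * x.1, x.2) := rfl

lemma shift_apply_shift_inv (t : G) (x : G × ℕ) : shift t (shift t⁻¹ x) = x := by
  simp [shift_apply]

lemma tendsto_norm_trunc_permute_shift (S : Finset (G × ℕ)) (v : SqSummable (G × ℕ)) :
    Tendsto (fun g => ‖trunc S (permute (shift g) v)‖) cofinite (𝓝 0) := by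
  have h : Tendsto (fun g => ‖trunc S (permute (shift g) v)‖ ^ 2) cofinite (𝓝 0) := by
    simp only [norm_sq_trunc]
    rw [← Finset.sum_const_zero (s := S)]
    refine tendsto_finsetSum _ fun x _ => ?_
    have hinj : Function.Injective fun g : G => (g⁻¹ * x.1, x.2) := fun g h hgh => by
      simpa using hgh
    exact (hasSum_sq v).summable.tendsto_cofinite_zero.comp hinj.tendsto_cofinite
  simpa [Function.comp_def, Real.sqrt_sq (norm_nonneg _)] using
    (Real.continuous_sqrt.tendsto _).comp h

lemma smallAtInfinity_translate {f : G → ℂ} (hf : f ∈ SmallAtInfinity G) (t : G) :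
    (fun s => f (t * s)) ∈ SmallAtInfinity G := by
  rw [mem_smallAtInfinity_iff] at *
  obtain ⟨⟨C, hC⟩, hf⟩ := hf
  refine ⟨⟨C, fun x => hC _⟩, fun s => ?_⟩
  simpa [Function.comp_def, mul_assoc] using (hf s).comp (mul_right_injective t).tendsto_cofinite

/-- The mean of `F` at `g` determined by the vector `b g`, at scales `R` and `ρ g + 1`. -/
noncomputable def cocycleMean (b : G → SqSummable (G × ℕ)) (E : ℕ → Finset (G × ℕ)) (ρ : G → ℕ)
    (R : ℝ) (F : G → ℂ) (g : G) : ℂ :=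
  mixed E R (ρ g + 1) (F ∘ Prod.fst) (b g)

omit [Group G] in
lemma norm_cocycleMean_le {b : G → SqSummable (G × ℕ)} {E : ℕ → Finset (G × ℕ)} {ρ : G → ℕ}
    {R : ℝ} {F : G → ℂ} {C : ℝ} (hC : 0 ≤ C) (hF : ∀ x, ‖F x‖ ≤ C) (g : G) :
    ‖cocycleMean b E ρ R F g‖ ≤ 2 * C :=
  norm_mixed_le hC (fun _ => hF _) _

variable {b : G → SqSummable (G × ℕ)} (hb : ∀ g h, b (g * h) = b g + permute (shift g) (b h))
  {E : ℕ → Finset (G × ℕ)} (hE : Monotone E)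
  (hshift : ∀ t : G, ∀ᶠ i in atTop, ∀ x ∈ E i, shift t x ∈ E (i + 1))
  {ρ : G → ℕ} (hρ : Tendsto ρ cofinite atTop)
  (hρr : ∀ t, ∀ᶠ g in cofinite, ρ (g * t) ≤ ρ g + 1 ∧ ρ g ≤ ρ (g * t) + 1)
  (hρl : ∀ t, ∀ᶠ g in cofinite, ρ (t * g) ≤ ρ g + 1 ∧ ρ g ≤ ρ (t * g) + 1)
  {R : ℝ} {F : G → ℂ} {C : ℝ}

omit [Group G] in
include hρ in
lemma tendsto_div_scale (a : ℝ) :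
    Tendsto (fun g => a / (ρ g + 1 : ℕ)) cofinite (𝓝 0) :=
  (tendsto_const_div_atTop_nhds_zero_nat a).comp ((tendsto_add_atTop_nat 1).comp hρ)

omit [Group G] in
include hρ in
lemma tendsto_log_div_scale :
    Tendsto (fun g => Real.log (ρ g + 1 : ℕ) / (ρ g + 1 : ℕ)) cofinite (𝓝 0) :=
  (Real.isLittleO_log_id_atTop.tendsto_div_nhds_zero.comp tendsto_natCast_atTop_atTop).comp
    ((tendsto_add_atTop_nat 1).comp hρ)

include hb hE hρ hρr in
lemma cocycleMean_mem_smallAtInfinity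
    (hvan : ∀ s, Tendsto (fun g => ‖trunc (E (ρ g)) (permute (shift g) (b s))‖) cofinite (𝓝 0))
    (hR : 0 < R) (hC : 0 ≤ C) (hF : ∀ x, ‖F x‖ ≤ C) :
    cocycleMean b E ρ R F ∈ SmallAtInfinity G := by
  rw [mem_smallAtInfinity_iff]
  refine ⟨⟨2 * C, norm_cocycleMean_le hC hF⟩, fun s => ?_⟩
  have hlim := (tendsto_div_scale hρ (8 * C * (‖b s‖ + 1) + 2 * C)).add
    (((hvan s).const_mul (4 * C)).div_const R)
  rw [mul_zero, zero_div, add_zero] at hlim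
  refine squeeze_zero_norm' ?_ hlim
  filter_upwards [hρr s] with g hg
  have h := norm_mixed_sub_le_of_trunc hR hE hg.1 hg.2 hC (F := F ∘ Prod.fst) (fun _ => hF _)
    (b (g * s)) (b g)
  rwa [hb, add_sub_cancel_left, norm_permute, ← hb] at h

include hb hE hshift hρ hρl in
lemma norm_cocycleMean_translate_sub_le (hR : 1 ≤ R) (hC : 0 ≤ C) (hF : ∀ x, ‖F x‖ ≤ C) (t : G) :
    ∀ᶠ g in cofinite, ‖cocycleMean b E ρ R F (t * g)
      - cocycleMean b E ρ R (fun s => F (t * s)) g‖ ≤ (4 * C * ‖b t‖ + 1) / R := by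
  obtain ⟨i₀, hi₀⟩ := eventually_atTop.1 ((hshift t).and (hshift t⁻¹))
  have hE' : ∀ i ≥ i₀ + 1, (E i).map (shift t).toEmbedding ⊆ E (i + 1) ∧
      E (i - 1) ⊆ (E i).map (shift t).toEmbedding := fun i hi => by
    refine ⟨Finset.map_subset_iff_subset_preimage.2 fun x hx => ?_, fun x hx => ?_⟩
    · simpa using (hi₀ i (by omega)).1 x hx
    · have h := (hi₀ (i - 1) (by omega)).2 x hx
      rw [Nat.sub_add_cancel (by omega)] at h
      exact Finset.mem_map.2 ⟨_, h, shift_apply_shift_inv t x⟩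
  have hlim : Tendsto (fun g => (8 * C * (‖b t‖ + 1) + 2 * C) / (ρ g + 1 : ℕ)
      + (16 * C * (Real.log (ρ g + 1 : ℕ) / (ρ g + 1 : ℕ)) + 8 * C / (ρ g + 1 : ℕ)
        + 2 * C * (i₀ + 1 : ℕ) / (ρ g + 1 : ℕ))) cofinite (𝓝 0) := by
    simpa using (tendsto_div_scale hρ _).add ((((tendsto_log_div_scale hρ).const_mul (16 * C)).add
      (tendsto_div_scale hρ _)).add (tendsto_div_scale hρ _))
  have hR0 : 0 < R := by linarith
  filter_upwards [hρl t, hlim.eventually_le_const (one_div_pos.2 hR0)] with g hg hsmall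
  have h := norm_mixed_sub_le_of_shift hR hE hE' (ρ g).succ_pos (ρ (t * g)).succ_pos
    (by omega) (by omega) hC (F := F ∘ Prod.fst) (fun _ => hF _) (b (t * g))
    (permute (shift t) (b g))
  rw [← mixed_comp_permute, hb, add_sub_cancel_right, ← hb] at h
  refine h.trans (le_trans (le_of_eq ?_) (add_le_add_right hsmall (4 * C * ‖b t‖ / R)) |>.trans_eq
    (add_div _ _ _).symm)
  simp only [Nat.succ_eq_add_one]
  ring

include hb hE hshift hρ hρl in
lemma mass_le_cocycleMean_add (hex : ∀ x, ∃ i, x ∈ E i) (hub : ∀ C : ℝ, ∃ g : G, C < ‖b g‖)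
    (hR : 0 < R) : ∃ t, ∀ᶠ g in cofinite, 1 / 4 ≤ (cocycleMean b E ρ R (fun _ => 1) (t * g)).re
      + (cocycleMean b E ρ R (fun _ => 1) g).re := by
  obtain ⟨t, ht⟩ := hub (2 * R)
  obtain ⟨i₀, hi₀⟩ := eventually_atTop.1 ((hshift t⁻¹).and
    ((tendsto_norm_trunc hE hex (b t)).eventually_const_le ht))
  refine ⟨t, ?_⟩
  filter_upwards [hρl t, (tendsto_div_scale hρ (i₀ + 3)).eventually_le_const
    (by norm_num : (0 : ℝ) < 1 / 4)] with g hg hsmall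
  have h := mass_le_mixed_add_mixed (E := E) hR (ρ g).succ_pos (ρ (t * g)).succ_pos
    (by omega) (by omega) (v := b (t * g)) (w := b g) (i₀ := i₀) fun i hi => by
      obtain ⟨h1, h2⟩ := hi₀ i hi
      have h3 : ‖trunc (E i) (permute (shift t) (b g))‖ ≤ ‖trunc (E (i + 1)) (b g)‖ := by
        rw [← norm_permute (shift t) (trunc (E (i + 1)) (b g)), permute_trunc]
        exact norm_trunc_mono
          (fun x hx => Finset.mem_map.2 ⟨_, h1 x hx, shift_apply_shift_inv t x⟩) _
      have h4 := norm_sub_le (trunc (E i) (b (t * g))) (trunc (E i) (permute (shift t) (b g)))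
      rw [← trunc_sub, hb, add_sub_cancel_right, ← hb] at h4
      linarith
  refine le_trans ?_ h
  simp only [Nat.succ_eq_add_one]
  linarith

end Cocycle

section Main

variable {G : Type*} [Group G] [Countable G]

/-- Scales at which the translates of the vectors `b s` become negligible. -/
lemma exists_scale (b : G → SqSummable (G × ℕ)) (E : ℕ → Finset (G × ℕ)) :
    ∃ ρ : G → ℕ, Tendsto ρ cofinite atTop ∧
      (∀ t, ∀ᶠ g in cofinite, ρ (g * t) ≤ ρ g + 1 ∧ ρ g ≤ ρ (g * t) + 1) ∧
      (∀ t, ∀ᶠ g in cofinite, ρ (t * g) ≤ ρ g + 1 ∧ ρ g ≤ ρ (t * g) + 1) ∧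
      ∀ s, Tendsto (fun g => ‖trunc (E (ρ g)) (permute (shift g) (b s))‖) cofinite (𝓝 0) := by
  obtain ⟨S, hS⟩ := exists_exhaustion G
  have hfin : ∀ n, {g | ¬ ∀ s ∈ S n,
      ‖trunc (E n) (permute (shift g) (b s))‖ ≤ 1 / ((n : ℝ) + 1)}.Finite := fun n => by
    rw [← eventually_cofinite, eventually_all_finset]
    exact fun s _ => (tendsto_norm_trunc_permute_shift (E n) (b s)).eventually_le_const
      Nat.one_div_pos_of_nat
  obtain ⟨ρ, hρ, hr, hl, hA⟩ := exists_slow fun n => (hfin n).toFinset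
  refine ⟨ρ, hρ, hr, hl, fun s => ?_⟩
  refine squeeze_zero' (Eventually.of_forall fun _ => norm_nonneg _) ?_
    ((tendsto_one_div_add_atTop_nhds_zero_nat (𝕜 := ℝ)).comp hρ)
  filter_upwards [hA, hρ.eventually (hS s)] with g hg hs
  simp only [Set.Finite.mem_toFinset, Set.mem_ofPred_eq, not_not] at hg
  exact hg s hs

lemma IsLeftInvariantState.amenableGroup_of_unbounded_cocycle {φ : (G → ℂ) → ℂ}
    (hφ : IsLeftInvariantState (SmallAtInfinity G) φ) {b : G → SqSummable (G × ℕ)}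
    (hb : ∀ g h, b (g * h) = b g + permute (shift g) (b h))
    (hub : ∀ C : ℝ, ∃ g : G, C < ‖b g‖) : AmenableGroup G := by
  have : Infinite G := by
    by_contra hfin
    rw [not_infinite_iff_finite] at hfin
    obtain ⟨C, hC⟩ := (Set.finite_range fun g => ‖b g‖).bddAbove
    obtain ⟨g, hg⟩ := hub C
    exact hg.not_ge (hC ⟨g, rfl⟩)
  obtain ⟨E, hE, hex, -, hshift⟩ := exists_chain (fun t : G => shift t) fun _ => ∅
  obtain ⟨ρ, hρ, hρr, hρl, hvan⟩ := exists_scale b E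
  have hR : ∀ n : ℕ, (0 : ℝ) < n + 1 := fun n => by positivity
  have hmem : ∀ n : ℕ, ∀ F ∈ BddFuns G, cocycleMean b E ρ (n + 1) F ∈ SmallAtInfinity G := by
    rintro n F ⟨C, hC⟩
    exact cocycleMean_mem_smallAtInfinity hb hE hρ hρr hvan (hR n)
      ((norm_nonneg _).trans (hC 1)) hC
  have hone : (fun _ : G => (1 : ℂ)) ∈ BddFuns G := ⟨1, by simp⟩
  have htrans : ∀ t, ∀ f ∈ SmallAtInfinity G, φ (fun s => f (t * s)) = φ f := fun t f hf => by
    simpa using hφ.map_translate t⁻¹ f hf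
  refine amenableGroup_of_asymptotic (fun n F => φ (cocycleMean b E ρ (n + 1) F))
    (fun n F hF F' hF' => ?_) (fun n c F hF => ?_) (fun n F hF h0 => ?_) (fun F hF => ?_)
    (c := 1 / 8) (by norm_num) (fun n => ?_) fun t F hF => ?_
  · rw [← hφ.map_add _ (hmem n F hF) _ (hmem n F' hF')]
    congr 1
    ext g
    obtain ⟨C, hC⟩ := hF
    obtain ⟨C', hC'⟩ := hF'
    exact mixed_add (fun _ => hC _) (fun _ => hC' _) _
  · rw [← hφ.map_smul _ _ (hmem n F hF)]
    congr 1
    ext g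
    exact mixed_const_smul _ _ _
  · have h := hφ.nonneg _ (hmem n F hF) fun g => by
      have h1 := Complex.le_def.1
        (mixed_nonneg (E := E) (R := n + 1) (N := ρ g + 1) (fun x : G × ℕ => h0 x.1) (b g))
      exact ⟨h1.1, h1.2.symm⟩
    exact Complex.le_def.2 ⟨h.1, h.2.symm⟩
  · obtain ⟨C, hC⟩ := id hF
    exact ⟨2 * C, fun n => hφ.norm_le_of_eventually (hmem n F hF)
      (Eventually.of_forall (norm_cocycleMean_le ((norm_nonneg _).trans (hC 1)) hC))⟩
  · obtain ⟨t, ht⟩ := mass_le_cocycleMean_add hb hE hshift hρ hρl hex hub (hR n)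
    have hf := hmem n _ hone
    have hft := smallAtInfinity_translate hf t
    have h := hφ.re_le_of_eventually (C := -(1 / 4))
      (smallAtInfinity_smul (smallAtInfinity_add hft hf) (-1)) (ht.mono fun g hg => by
        simp only [Pi.smul_apply, Pi.add_apply, neg_smul, one_smul, Complex.neg_re,
          Complex.add_re]
        linarith)
    rw [hφ.map_smul _ _ (smallAtInfinity_add hft hf), hφ.map_add _ hft _ hf, htrans t _ hf,
      neg_one_mul, Complex.neg_re, Complex.add_re] at h
    linarith
  · obtain ⟨C, hC⟩ := id hF
    have hC0 := (norm_nonneg _).trans (hC 1)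
    have hFt : (fun s => F (t⁻¹ * s)) ∈ BddFuns G := ⟨C, fun _ => hC _⟩
    refine squeeze_zero_norm (fun n => ?_)
      (((tendsto_const_div_atTop_nhds_zero_nat (4 * C * ‖b t‖ + 1))).comp (tendsto_add_atTop_nat 1))
    have h1 := hmem n _ hFt
    have h2 := hmem n F hF
    have h3 := smallAtInfinity_translate h1 t
    rw [← htrans t _ h1, sub_eq_add_neg, ← neg_one_mul, ← hφ.map_smul _ _ h2,
      ← hφ.map_add _ h3 _ (smallAtInfinity_smul h2 _)]
    refine hφ.norm_le_of_eventually (smallAtInfinity_add h3 (smallAtInfinity_smul h2 _)) ?_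
    filter_upwards [norm_cocycleMean_translate_sub_le hb hE hshift hρ hρl (R := n + 1) (by simp)
      hC0 (fun s => hC (t⁻¹ * s)) t] with g hg
    simpa [sub_eq_add_neg] using hg

end Main

end ProperProximality

/-- Theorem 1.1: a countable, nonamenable, exact group admitting an unbounded 1-cocycle into a
countable multiple `λ^{⊕∞}` of its left regular representation (i.e. with `β₁⁽²⁾(G) > 0`) is
properly proximal. -/
theorem stmt0 (G : Type*) [Group G] [Countable G]
    (hNA : ¬ AmenableGroup G) (hA : HasPropertyA G)
    (b : G → lp (fun _ : G × ℕ => ℂ) 2)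
    (hcoc : ∀ g h : G, ∀ x : G, ∀ n : ℕ,
      (b (g * h) : (G × ℕ) → ℂ) (x, n)
        = (b g : (G × ℕ) → ℂ) (x, n) + (b h : (G × ℕ) → ℂ) (g⁻¹ * x, n))
    (hub : ∀ C : ℝ, ∃ g : G, C < ‖b g‖) :
    ProperlyProximalGroup G := by
  rintro ⟨φ, h1, h2, h3, h4, h5⟩
  refine hNA (ProperProximality.IsLeftInvariantState.amenableGroup_of_unbounded_cocycle
    ⟨h1, h2, h3, h4, h5⟩ (b := b) (fun g h => ?_) hub)
  ext ⟨x, n⟩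
  exact hcoc g h x n
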